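/- arXiv:1508.03062 — 2 statements merged into one kernel-verified Lean document; each statement's English description precedes it below -/
import Mathlib

section
/- Let G be an even-hole-free graph and let B be an ℓ-buoy in G with ℓ odd, ℓ ≥ 5. Then for every bag B_i and every pair of vertices x, y in B_i, x and y are comparable within B: either every neighbor of x in B \ {y} is a neighbor of y, or every neighbor of y in B \ {x} is a neighbor of x. In particular, each bag B_i contains a vertex adjacent to all other vertices of B_i's neighborhood in B (a dominant vertex of B_i). -/
def IsHole {V : Type*} (G : SimpleGraph V) (n : ℕ) (f : ZMod n → V) : Prop :=
  4 ≤ n ∧ Function.Injective f ∧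
    ∀ i j : ZMod n, G.Adj (f i) (f j) ↔ (j = i + 1 ∨ i = j + 1)

def HasInducedPan {V : Type*} (G : SimpleGraph V) : Prop :=
  ∃ (n : ℕ) (f : ZMod n → V) (x : V),
    IsHole G n f ∧ x ∉ Set.range f ∧ ∃! i : ZMod n, G.Adj x (f i)

def HasEvenHole {V : Type*} (G : SimpleGraph V) : Prop :=
  ∃ (n : ℕ) (f : ZMod n → V), IsHole G n f ∧ Even n

def IsBuoy {V : Type*} (G : SimpleGraph V) (ℓ : ℕ) (B : ZMod ℓ → Set V) : Prop :=
  5 ≤ ℓ ∧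
  (∀ i, (B i).Nonempty) ∧
  (∀ i, G.IsClique (B i)) ∧
  (Pairwise fun i j => Disjoint (B i) (B j)) ∧
  (∀ i, ∀ v ∈ B i, ∃ u ∈ B (i + 1), G.Adj v u) ∧
  (∀ i, ∀ v ∈ B i, ∃ u ∈ B (i - 1), G.Adj v u) ∧
  (∀ i j : ZMod ℓ, j ≠ i → j ≠ i + 1 → j ≠ i - 1 →
    ∀ v ∈ B i, ∀ u ∈ B j, ¬ G.Adj v u)

theorem val_succ_iff (n : ℕ) (hn : 4 ≤ n) (i j : ZMod n) :
    j = i + 1 ↔ (j.val = i.val + 1 ∨ (i.val + 1 = n ∧ j.val = 0)) := by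
  have : NeZero n := ⟨by omega⟩
  have : Fact (1 < n) := ⟨by omega⟩
  have hi := ZMod.val_lt i
  have hj := ZMod.val_lt j
  rw [← (ZMod.val_injective n).eq_iff, ZMod.val_add, ZMod.val_one]
  rcases Nat.lt_or_ge (i.val + 1) n with h | h
  · rw [Nat.mod_eq_of_lt h]; omega
  · have : i.val + 1 = n := by omega
    rw [this, Nat.mod_self]; omega

theorem hole_of_seq {V : Type*} (G : SimpleGraph V) (heven : ¬ HasEvenHole G)
    (n : ℕ) (hn : 4 ≤ n) (he : Even n) (c : ℕ → V)
    (hinj : ∀ a b, a < b → b < n → c a ≠ c b)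
    (hadj : ∀ a b, a < b → b < n → (G.Adj (c a) (c b) ↔ (b = a + 1 ∨ (a = 0 ∧ b + 1 = n)))) :
    False := by
  apply heven
  have : NeZero n := ⟨by omega⟩
  refine ⟨n, fun t => c t.val, ⟨hn, ?_, ?_⟩, he⟩
  · intro s t h
    have hs := ZMod.val_lt s
    have ht := ZMod.val_lt t
    apply ZMod.val_injective n
    rcases lt_trichotomy s.val t.val with h' | h' | h'
    · exact absurd h (hinj _ _ h' ht)
    · exact h'
    · exact absurd h.symm (hinj _ _ h' hs)
  · intro s t
    have hs := ZMod.val_lt s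
    have ht := ZMod.val_lt t
    rw [val_succ_iff n hn, val_succ_iff n hn]
    rcases lt_trichotomy s.val t.val with h' | h' | h'
    · rw [hadj _ _ h' ht]; omega
    · simp only [h', SimpleGraph.irrefl, false_iff]; omega
    · rw [G.adj_comm, hadj _ _ h' hs]; omega

theorem c4_free {V : Type*} (G : SimpleGraph V) (heven : ¬ HasEvenHole G)
    {x p q y : V} (hxq : x ≠ q) (hpy : p ≠ y)
    (h1 : G.Adj x p) (h2 : G.Adj p q) (h3 : G.Adj q y) (h4 : G.Adj y x)
    (h5 : ¬ G.Adj x q) (h6 : ¬ G.Adj y p) : False := by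
  have e0 := h1.ne
  have e1 := h2.ne
  have e2 := h3.ne
  have e3 := h4.ne
  have h6' : ¬ G.Adj p y := fun h => h6 h.symm
  refine hole_of_seq G heven 4 le_rfl (by decide)
    (fun k => if k = 0 then x else if k = 1 then p else if k = 2 then q else y) ?_ ?_
  · intro a b hab hb
    interval_cases b <;> interval_cases a <;> simp [*, e3.symm]
  · intro a b hab hb
    interval_cases b <;> interval_cases a <;> simp [*, h4.symm]

theorem natCast_ne_zero' {ℓ n : ℕ} (h0 : 0 < n) (h1 : n < ℓ) : (n : ZMod ℓ) ≠ 0 := by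
  intro h
  rw [ZMod.natCast_eq_zero_iff] at h
  exact absurd (Nat.le_of_dvd h0 h) (by omega)

theorem buoy_ne {V : Type*} {G : SimpleGraph V} {ℓ : ℕ} {B : ZMod ℓ → Set V}
    (hB : IsBuoy G ℓ B) {i j : ZMod ℓ} (n : ℕ) (h0 : 0 < n) (h1 : n < ℓ)
    (hj : j = i + n) {u v : V} (hu : u ∈ B i) (hv : v ∈ B j) : u ≠ v := by
  rintro rfl
  have hne : i ≠ j := by
    intro h
    apply natCast_ne_zero' h0 h1
    rw [← h] at hj
    simpa using hj
  exact Set.disjoint_left.mp (hB.2.2.2.1 hne) hu hv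

theorem buoy_nonadj {V : Type*} {G : SimpleGraph V} {ℓ : ℕ} {B : ZMod ℓ → Set V}
    (hB : IsBuoy G ℓ B) {i j : ZMod ℓ} (n : ℕ) (h0 : 2 ≤ n) (h1 : n + 2 ≤ ℓ)
    (hj : j = i + n) {u v : V} (hu : u ∈ B i) (hv : v ∈ B j) : ¬ G.Adj u v := by
  subst hj
  refine hB.2.2.2.2.2.2 i _ ?_ ?_ ?_ u hu v hv
  · intro h
    exact natCast_ne_zero' (ℓ := ℓ) (n := n) (by omega) (by omega) (by simpa using h)
  · intro h
    obtain ⟨m, rfl⟩ : ∃ m, n = m + 1 := ⟨n - 1, by omega⟩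
    refine natCast_ne_zero' (ℓ := ℓ) (n := m) (by omega) (by omega) ?_
    push_cast at h
    linear_combination h
  · intro h
    refine natCast_ne_zero' (ℓ := ℓ) (n := n + 1) (by omega) (by omega) ?_
    push_cast
    linear_combination h

theorem twist {V : Type*} {G : SimpleGraph V} (heven : ¬ HasEvenHole G)
    {ℓ : ℕ} (hodd : Odd ℓ) {B : ZMod ℓ → Set V} (hB : IsBuoy G ℓ B) (i : ZMod ℓ) (c : ℕ → V)
    (hc : ∀ k ≤ ℓ, c k ∈ B (i + k)) (hadj : ∀ k < ℓ, G.Adj (c k) (c (k + 1)))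
    (h1 : ¬ G.Adj (c 0) (c (ℓ - 1))) (h2 : ¬ G.Adj (c 1) (c ℓ)) : False := by
  have hℓ : 5 ≤ ℓ := hB.1
  have h0ℓ : c 0 ≠ c ℓ := by
    intro h
    have := hadj 0 (by omega)
    rw [h] at this
    exact h2 this.symm
  have hz : G.Adj (c 0) (c ℓ) := by
    refine hB.2.2.1 i ?_ ?_ h0ℓ
    · simpa using hc 0 (by omega)
    · simpa using hc ℓ le_rfl
  have key : ∀ a b : ℕ, a < b → (i + (b : ZMod ℓ)) = (i + (a : ZMod ℓ)) + ((b - a : ℕ) : ZMod ℓ) := by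
    intro a b hab
    rw [Nat.cast_sub hab.le]; ring
  refine hole_of_seq G heven (ℓ + 1) (by omega) hodd.add_one c ?_ ?_
  · intro a b hab hb
    by_cases h : b - a = ℓ
    · have ha : a = 0 := by omega
      have hb' : b = ℓ := by omega
      subst ha hb'
      exact h0ℓ
    · exact buoy_ne hB (b - a) (by omega) (by omega) (key a b hab) (hc a (by omega)) (hc b (by omega))
  · intro a b hab hb
    constructor
    · intro h
      by_contra hcon
      by_cases h3 : b - a = ℓ - 1
      · rcases Nat.eq_zero_or_pos a with ha | ha
        · have hb' : b = ℓ - 1 := by omega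
          rw [ha, hb'] at h
          exact h1 h
        · have ha' : a = 1 := by omega
          have hb' : b = ℓ := by omega
          rw [ha', hb'] at h
          exact h2 h
      · exact buoy_nonadj hB (b - a) (by omega) (by omega) (key a b hab)
          (hc a (by omega)) (hc b (by omega)) h
    · rintro (h | ⟨h, h'⟩)
      · rw [h]; exact hadj a (by omega)
      · have hb' : b = ℓ := by omega
        rw [h, hb']; exact hz

theorem exists_path {V : Type*} {G : SimpleGraph V} {ℓ : ℕ} {B : ZMod ℓ → Set V}
    (i s : ZMod ℓ) (hs : ∀ i, ∀ v ∈ B i, ∃ u ∈ B (i + s), G.Adj v u)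
    {x p : V} (hx : x ∈ B i) (hp : p ∈ B (i + s)) (hxp : G.Adj x p) :
    ∃ a : ℕ → V, a 0 = x ∧ a 1 = p ∧ (∀ k : ℕ, a k ∈ B (i + k * s)) ∧
      ∀ k, G.Adj (a k) (a (k + 1)) := by
  classical
  choose! g hg hg' using hs
  let a : ℕ → V := fun k => Nat.rec p (fun m v => g (i + ((m + 1 : ℕ) : ZMod ℓ) * s) v) k
  have ha0 : a 0 = p := rfl
  have has : ∀ k, a (k + 1) = g (i + ((k + 1 : ℕ) : ZMod ℓ) * s) (a k) := fun k => rfl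
  have hm : ∀ k, a k ∈ B (i + ((k + 1 : ℕ) : ZMod ℓ) * s) := by
    intro k
    induction k with
    | zero => simpa [ha0] using hp
    | succ k ih =>
      rw [has]
      have := hg _ _ ih
      convert this using 2
      push_cast; ring
  refine ⟨fun k => if k = 0 then x else a (k - 1), by simp, by simp [ha0], ?_, ?_⟩
  · intro k
    rcases k with _ | k
    · simpa using hx
    · simpa using hm k
  · intro k
    rcases k with _ | k
    · simpa [ha0] using hxp
    · simpa [has] using hg' _ _ (hm k)

theorem no_twist {V : Type*} {G : SimpleGraph V} (heven : ¬ HasEvenHole G)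
    {ℓ : ℕ} (hodd : Odd ℓ) {B : ZMod ℓ → Set V} (hB : IsBuoy G ℓ B) (i : ZMod ℓ)
    {x y p q : V} (hx : x ∈ B i) (hy : y ∈ B i) (hp : p ∈ B (i + 1)) (hq : q ∈ B (i - 1))
    (hxp : G.Adj x p) (hyp : ¬ G.Adj y p) (hyq : G.Adj y q) (hxq : ¬ G.Adj x q) : False := by
  have hℓ : 5 ≤ ℓ := hB.1
  obtain ⟨a, a0, a1, ham, haa⟩ := exists_path i 1 hB.2.2.2.2.1 hx hp hxp
  obtain ⟨r, r0, r1, hrm, hra⟩ := exists_path (B := B) (G := G) i (-1)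
    (by simpa [sub_eq_add_neg] using hB.2.2.2.2.2.1) hy (by simpa [sub_eq_add_neg] using hq) hyq
  simp only [mul_one] at ham
  obtain ⟨b, hb⟩ : ∃ b : ℕ → V, ∀ k, b k = r (ℓ - k) := ⟨_, fun k => rfl⟩
  have bℓ : b ℓ = y := by rw [hb, Nat.sub_self, r0]
  have bq : b (ℓ - 1) = q := by rw [hb, show ℓ - (ℓ - 1) = 1 by omega, r1]
  have hbm : ∀ k ≤ ℓ, b k ∈ B (i + k) := by
    intro k hk
    rw [hb]
    convert hrm (ℓ - k) using 2
    rw [Nat.cast_sub hk]; simp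
  have hba : ∀ k < ℓ, G.Adj (b k) (b (k + 1)) := by
    intro k hk
    rw [hb, hb, show ℓ - k = (ℓ - (k + 1)) + 1 by omega]
    exact (hra _).symm
  clear hb hra hrm r0 r1
  -- no crossing edges from `a` to `b`
  have cross : ∀ j, 1 ≤ j → j + 1 < ℓ → ¬ G.Adj (a j) (b (j + 1)) := by
    intro j hj1 hj2 hadj
    refine twist heven hodd hB i (fun k => if k ≤ j then a k else b k) ?_ ?_ ?_ ?_
    · intro k hk
      split_ifs
      · exact ham k
      · exact hbm k hk
    · intro k hk
      rcases lt_trichotomy k j with h | h | h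
      · rw [if_pos h.le, if_pos (by omega)]; exact haa k
      · rw [if_pos h.le, if_neg (by omega), h]; exact hadj
      · rw [if_neg (by omega), if_neg (by omega)]; exact hba k hk
    · rw [if_pos (by omega), if_neg (by omega), a0, bq]; exact hxq
    · rw [if_pos hj1, if_neg (by omega), a1, bℓ]; exact fun h => hyp h.symm
  -- a vertex of the base bag closing up the path `a`
  obtain ⟨z, hz, hz1, hz2⟩ : ∃ z ∈ B i, G.Adj (a (ℓ - 1)) z ∧ G.Adj z (a 1) := by
    by_cases h1 : G.Adj (a 0) (a (ℓ - 1))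
    · exact ⟨a 0, by simpa using ham 0, h1.symm, haa 0⟩
    · refine ⟨a ℓ, by simpa using ham ℓ, ?_, ?_⟩
      · have := haa (ℓ - 1)
        rwa [show ℓ - 1 + 1 = ℓ by omega] at this
      · by_contra h2
        exact twist heven hodd hB i a (fun k _ => ham k) (fun k _ => haa k) h1
          (fun h => h2 h.symm)
  -- the last rung
  have rung : G.Adj (b (ℓ - 2)) (a (ℓ - 1)) := by
    have e : ℓ - 2 + 1 = ℓ - 1 := by omega
    have hA := haa (ℓ - 2)
    have hBB := hba (ℓ - 2) (by omega)
    have hX := cross (ℓ - 2) (by omega) (by omega)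
    rw [e] at hA hBB hX
    by_contra hcon
    have n1 : a (ℓ - 2) ≠ b (ℓ - 2) := by
      intro h; rw [h] at hX; exact hX hBB
    have n2 : a (ℓ - 1) ≠ b (ℓ - 1) := by
      intro h; rw [h] at hA; exact hX hA
    have key : i + ((ℓ - 1 : ℕ) : ZMod ℓ) = i + ((ℓ - 2 : ℕ) : ZMod ℓ) + ((1 : ℕ) : ZMod ℓ) := by
      rw [← e]; push_cast; ring
    exact c4_free G heven
      (buoy_ne hB 1 (by omega) (by omega) key (ham _) (hbm _ (by omega)))
      (buoy_ne hB 1 (by omega) (by omega) key (hbm _ (by omega)) (ham _)).symm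
      hA (hB.2.2.1 _ (ham _) (hbm _ (by omega)) n2) hBB.symm
      (hB.2.2.1 _ (hbm _ (by omega)) (ham _) n1.symm) hX hcon
  -- the second twisted cycle
  refine twist heven hodd hB (i + 2)
    (fun k => if k + 4 ≤ ℓ then b (k + 2) else if k + 3 = ℓ then a (ℓ - 1) else
      if k + 2 = ℓ then z else if k + 1 = ℓ then a 1 else a 2) ?_ ?_ ?_ ?_
  · intro k hk
    split_ifs with h1 h2 h3 h4
    · convert hbm (k + 2) (by omega) using 2
      push_cast; ring
    · convert ham (ℓ - 1) using 2
      rw [show ℓ - 1 = k + 2 by omega]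
      push_cast; ring
    · convert hz using 2
      have : ((k + 2 : ℕ) : ZMod ℓ) = 0 := by rw [h3]; simp
      push_cast at this
      linear_combination this
    · convert ham 1 using 2
      have : ((k + 1 : ℕ) : ZMod ℓ) = 0 := by rw [h4]; simp
      push_cast at this ⊢
      linear_combination this
    · convert ham 2 using 2
      have : ((k : ℕ) : ZMod ℓ) = 0 := by rw [show k = ℓ by omega]; simp
      push_cast at this ⊢
      linear_combination this
  · intro k hk
    rcases (by omega : k + 5 ≤ ℓ ∨ k + 4 = ℓ ∨ k + 3 = ℓ ∨ k + 2 = ℓ ∨ k + 1 = ℓ) with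
      h | h | h | h | h
    · rw [if_pos (by omega), if_pos (by omega)]
      exact hba (k + 2) (by omega)
    · rw [if_pos (by omega), if_neg (by omega), if_pos (by omega), show k + 2 = ℓ - 2 by omega]
      exact rung
    · rw [if_neg (by omega), if_pos (by omega), if_neg (by omega), if_neg (by omega),
        if_pos (by omega)]
      exact hz1
    · rw [if_neg (by omega), if_neg (by omega), if_pos (by omega), if_neg (by omega),
        if_neg (by omega), if_neg (by omega), if_pos (by omega)]
      exact hz2
    · rw [if_neg (by omega), if_neg (by omega), if_neg (by omega), if_pos (by omega),
        if_neg (by omega), if_neg (by omega), if_neg (by omega), if_neg (by omega)]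
      exact haa 1
  · rw [if_pos (by omega), if_neg (by omega), if_neg (by omega), if_neg (by omega),
      if_pos (by omega)]
    exact fun h => cross 1 le_rfl (by omega) h.symm
  · rw [if_pos (by omega), if_neg (by omega), if_neg (by omega), if_neg (by omega),
      if_neg (by omega)]
    exact fun h => cross 2 (by omega) (by omega) h.symm

theorem bag_nested {V : Type*} {G : SimpleGraph V} (heven : ¬ HasEvenHole G)
    {ℓ : ℕ} {B : ZMod ℓ → Set V} (hB : IsBuoy G ℓ B) {i j : ZMod ℓ} (hij : i ≠ j)
    {x y p q : V} (hx : x ∈ B i) (hy : y ∈ B i) (hp : p ∈ B j) (hq : q ∈ B j)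
    (hxp : G.Adj x p) (hyp : ¬ G.Adj y p) (hyq : G.Adj y q) (hxq : ¬ G.Adj x q) : False := by
  have hd := Set.disjoint_left.mp (hB.2.2.2.1 hij)
  have n1 : x ≠ y := by rintro rfl; exact hyp hxp
  have n2 : p ≠ q := by rintro rfl; exact hyp hyq
  exact c4_free G heven (by rintro rfl; exact hd hx hq) (by rintro rfl; exact hd hy hp)
    hxp (hB.2.2.1 _ hp hq n2) hyq.symm (hB.2.2.1 _ hy hx n1.symm) hxq hyp

theorem bag_comparable {V : Type*} {G : SimpleGraph V} (heven : ¬ HasEvenHole G)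
    {ℓ : ℕ} (hodd : Odd ℓ) {B : ZMod ℓ → Set V} (hB : IsBuoy G ℓ B) (i : ZMod ℓ)
    {x y : V} (hx : x ∈ B i) (hy : y ∈ B i) :
      (∀ z ∈ ⋃ j, B j, z ≠ y → G.Adj x z → G.Adj y z) ∨
      (∀ z ∈ ⋃ j, B j, z ≠ x → G.Adj y z → G.Adj x z) := by
  by_contra hcon
  push Not at hcon
  obtain ⟨⟨p, hp, hpy, hxp, hyp⟩, ⟨q, hq, hqx, hyq, hxq⟩⟩ := hcon
  have side : ∀ {x y p : V}, x ∈ B i → y ∈ B i → p ∈ ⋃ j, B j → p ≠ y → G.Adj x p →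
      ¬ G.Adj y p → p ∈ B (i + 1) ∨ p ∈ B (i - 1) := by
    intro x y p hx hy hp hpy hxp hyp
    obtain ⟨j, hj⟩ := Set.mem_iUnion.mp hp
    by_cases h1 : j = i + 1
    · left; rwa [← h1]
    by_cases h2 : j = i - 1
    · right; rwa [← h2]
    by_cases h0 : j = i
    · subst h0
      exact absurd (hB.2.2.1 _ hy hj hpy.symm) hyp
    · exact absurd hxp (hB.2.2.2.2.2.2 i j h0 h1 h2 x hx p hj)
  have hone : (1 : ZMod ℓ) ≠ 0 := by
    have := natCast_ne_zero' (ℓ := ℓ) (n := 1) (by omega) (by have := hB.1; omega)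
    simpa using this
  have e1 : i ≠ i + 1 := by intro h; exact hone (by linear_combination -h)
  have e2 : i ≠ i - 1 := by intro h; exact hone (by linear_combination h)
  rcases side hx hy hp hpy hxp hyp with hp' | hp' <;>
    rcases side hy hx hq hqx hyq hxq with hq' | hq'
  · exact bag_nested heven hB e1 hx hy hp' hq' hxp hyp hyq hxq
  · exact no_twist heven hodd hB i hx hy hp' hq' hxp hyp hyq hxq
  · exact no_twist heven hodd hB i hy hx hq' hp' hyq hxq hxp hyp
  · exact bag_nested heven hB e2 hx hy hp' hq' hxp hyp hyq hxq

theorem stmt_7 {V : Type*} [Fintype V] (G : SimpleGraph V)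
    (heven : ¬ HasEvenHole G)
    (ℓ : ℕ) (hodd : Odd ℓ) (B : ZMod ℓ → Set V) (hB : IsBuoy G ℓ B) :
    (∀ i : ZMod ℓ, ∀ x ∈ B i, ∀ y ∈ B i,
      (∀ z ∈ ⋃ j, B j, z ≠ y → G.Adj x z → G.Adj y z) ∨
      (∀ z ∈ ⋃ j, B j, z ≠ x → G.Adj y z → G.Adj x z)) ∧
    (∀ i : ZMod ℓ, ∃ d ∈ B i, ∀ x ∈ B i, ∀ z ∈ ⋃ j, B j,
      z ≠ d → G.Adj x z → G.Adj d z) := by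
  refine ⟨fun i x hx y hy => bag_comparable heven hodd hB i hx hy, fun i => ?_⟩
  let r : B i → B i → Prop := fun x y =>
    ∀ z ∈ ⋃ j, B j, z ≠ (y : V) → G.Adj (x : V) z → G.Adj (y : V) z
  have hrefl : ∀ x, r x x := fun x z _ _ h => h
  have : IsTrans (B i) r := ⟨by
    intro x y w hxy hyw z hz hzw hxz
    by_cases hzy : z = (y : V)
    · rw [hzy] at hzw ⊢
      exact hB.2.2.1 i w.2 y.2 hzw.symm
    · exact hyw z hz hzw (hxy z hz hzy hxz)⟩
  have : Nonempty (B i) := (hB.2.1 i).to_subtype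
  have hdir : Directed r (id : B i → B i) := by
    intro x y
    rcases bag_comparable heven hodd hB i x.2 y.2 with h | h
    · exact ⟨y, h, hrefl y⟩
    · exact ⟨x, hrefl x, h⟩
  obtain ⟨d, hd⟩ := hdir.finite_set_le (Set.toFinite (Set.univ : Set (B i)))
  exact ⟨d, d.2, fun x hx => hd ⟨x, hx⟩ (Set.mem_univ _)⟩
end

section
/- Let G be a (pan, even hole)-free graph, B an odd ℓ-buoy in G (ℓ ≥ 5), and x a vertex outside B with at least one neighbor in B. If x has neighbors in every bag of B, then x is adjacent to every vertex of B; otherwise x has neighbors in exactly two or exactly three bags, and if exactly three, they are three consecutive bags B_{i-1}, B_i, B_{i+1}. -/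
theorem mkHole {V : Type*} (G : SimpleGraph V) (n : ℕ) (hn : 4 ≤ n) (F : ℕ → V)
    (hne : ∀ a b, a < b → b < n → F a ≠ F b)
    (hadj : ∀ a b, a < b → b < n → (G.Adj (F a) (F b) ↔ (b = a + 1 ∨ (a = 0 ∧ b + 1 = n)))) :
    IsHole G n (fun i : ZMod n => F i.val) := by
  have : NeZero n := ⟨by omega⟩
  have : Fact (1 < n) := ⟨by omega⟩
  have key : ∀ i j : ZMod n, i.val < j.val →
      (G.Adj (F i.val) (F j.val) ↔ (j = i + 1 ∨ i = j + 1)) := by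
    intro i j hij
    have hj := ZMod.val_lt j
    rw [hadj _ _ hij hj]
    have e1 : j = i + 1 ↔ j.val = i.val + 1 := by
      rw [← (ZMod.val_injective n).eq_iff, ZMod.val_add, ZMod.val_one, Nat.mod_eq_of_lt (by omega)]
    have e2 : i = j + 1 ↔ (i.val = 0 ∧ j.val + 1 = n) := by
      rw [← (ZMod.val_injective n).eq_iff, ZMod.val_add, ZMod.val_one]
      by_cases h : j.val + 1 = n
      · rw [h, Nat.mod_self]; simp
      · rw [Nat.mod_eq_of_lt (by omega)]; omega
    rw [e1, e2]
  refine ⟨hn, ?_, ?_⟩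
  · intro i j hij
    apply ZMod.val_injective n
    by_contra hne'
    rcases Nat.lt_or_gt_of_ne hne' with h | h
    · exact hne _ _ h (ZMod.val_lt j) hij
    · exact hne _ _ h (ZMod.val_lt i) hij.symm
  · intro i j
    rcases Nat.lt_trichotomy i.val j.val with h | h | h
    · exact key i j h
    · have : i = j := ZMod.val_injective n h
      subst this
      simp
    · rw [G.adj_comm, or_comm]
      exact key j i h

theorem noEven {V : Type*} {G : SimpleGraph V} (heven : ¬ HasEvenHole G)
    (n : ℕ) (hn : 4 ≤ n) (hev : Even n) (F : ℕ → V)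
    (hne : ∀ a b, a < b → b < n → F a ≠ F b)
    (hadj : ∀ a b, a < b → b < n → (G.Adj (F a) (F b) ↔ (b = a + 1 ∨ (a = 0 ∧ b + 1 = n)))) :
    False :=
  heven ⟨n, _, mkHole G n hn F hne hadj, hev⟩

theorem noPan {V : Type*} {G : SimpleGraph V} (hpan : ¬ HasInducedPan G)
    (n : ℕ) (hn : 4 ≤ n) (F : ℕ → V)
    (hne : ∀ a b, a < b → b < n → F a ≠ F b)
    (hadj : ∀ a b, a < b → b < n → (G.Adj (F a) (F b) ↔ (b = a + 1 ∨ (a = 0 ∧ b + 1 = n))))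
    (y : V) (hy : ∀ a, a < n → y ≠ F a) (c : ℕ) (hc : c < n) (hyc : G.Adj y (F c))
    (hu : ∀ a, a < n → G.Adj y (F a) → a = c) : False := by
  have : NeZero n := ⟨by omega⟩
  refine hpan ⟨n, _, y, mkHole G n hn F hne hadj, ?_, (c : ZMod n), ?_, ?_⟩
  · rintro ⟨i, hi⟩
    exact hy _ (ZMod.val_lt i) hi.symm
  · simpa [ZMod.val_natCast, Nat.mod_eq_of_lt hc] using hyc
  · intro j hj
    have := hu _ (ZMod.val_lt j) hj
    rw [← this, ZMod.natCast_zmod_val]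

theorem noC4 {V : Type*} {G : SimpleGraph V} (heven : ¬ HasEvenHole G)
    {a b c d : V} (hab : G.Adj a b) (hbc : G.Adj b c) (hcd : G.Adj c d) (hda : G.Adj d a)
    (hac : ¬ G.Adj a c) (hac' : a ≠ c) (hbd' : b ≠ d) : G.Adj b d := by
  by_contra hbd
  refine noEven heven 4 le_rfl (by decide)
    (fun k => if k = 0 then a else if k = 1 then b else if k = 2 then c else d) ?_ ?_
  · intro i j hij hj
    have := hab.ne; have := hbc.ne; have := hcd.ne; have := hda.ne
    interval_cases j <;> interval_cases i <;> simp_all [Ne.symm]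
  · intro i j hij hj
    have := hda.symm
    interval_cases j <;> interval_cases i <;> simp_all

theorem cast_eq_iff {ℓ : ℕ} {a b : ℕ} (ha : a < ℓ) (hb : b < ℓ) :
    ((a : ZMod ℓ) = (b : ZMod ℓ)) ↔ a = b := by
  rw [ZMod.natCast_eq_natCast_iff', Nat.mod_eq_of_lt ha, Nat.mod_eq_of_lt hb]

section buoy

variable {V : Type*} {G : SimpleGraph V} {ℓ : ℕ} {B : ZMod ℓ → Set V}

def Tr (G : SimpleGraph V) (B : ZMod ℓ → Set V) (h : ZMod ℓ → V) : Prop :=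
  ∀ i, h i ∈ B i ∧ G.Adj (h i) (h (i + 1))

theorem zne (h5 : 5 ≤ ℓ) : (1 : ZMod ℓ) ≠ 0 ∧ (2 : ZMod ℓ) ≠ 0 ∧ (3 : ZMod ℓ) ≠ 0 ∧
    (4 : ZMod ℓ) ≠ 0 := by
  have key : ∀ k : ℕ, 0 < k → k < 5 → ((k : ℕ) : ZMod ℓ) ≠ 0 := by
    intro k h1 h2 h
    have := (cast_eq_iff (ℓ := ℓ) (a := k) (b := 0) (by omega) (by omega)).1 (by simpa using h)
    omega
  exact ⟨by simpa using key 1 (by omega) (by omega), by simpa using key 2 (by omega) (by omega),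
    by simpa using key 3 (by omega) (by omega), by simpa using key 4 (by omega) (by omega)⟩

theorem bag_ne (hB : IsBuoy G ℓ B) {i j : ZMod ℓ} (hij : i ≠ j) {u v : V} (hu : u ∈ B i)
    (hv : v ∈ B j) : u ≠ v := by
  rintro rfl
  exact Set.disjoint_left.1 (hB.2.2.2.1 hij) hu hv

theorem bag_adj (hB : IsBuoy G ℓ B) {i j : ZMod ℓ} {u v : V} (hu : u ∈ B i)
    (hv : v ∈ B j) (h : G.Adj u v) : j = i ∨ j = i + 1 ∨ j = i - 1 := by
  by_contra hc
  push Not at hc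
  exact hB.2.2.2.2.2.2 i j hc.1 hc.2.1 hc.2.2 u hu v hv h

theorem nat_ne (hB : IsBuoy G ℓ B) {i : ZMod ℓ} {a b : ℕ} (hab : a < b) (hb : b < ℓ) {u v : V}
    (hu : u ∈ B (i + a)) (hv : v ∈ B (i + b)) : u ≠ v := by
  refine bag_ne hB ?_ hu hv
  intro h
  have := (cast_eq_iff (by omega) hb).1 (add_left_cancel h)
  omega

theorem nat_adj (hB : IsBuoy G ℓ B) {i : ZMod ℓ} {a b : ℕ} (hab : a < b) (hb : b < ℓ) {u v : V}
    (hu : u ∈ B (i + a)) (hv : v ∈ B (i + b)) (h : G.Adj u v) :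
    b = a + 1 ∨ (a = 0 ∧ b + 1 = ℓ) := by
  rcases bag_adj hB hu hv h with h | h | h
  · have := (cast_eq_iff hb (by omega)).1 (add_left_cancel h)
    omega
  · left
    have h' : ((b : ℕ) : ZMod ℓ) = ((a + 1 : ℕ) : ZMod ℓ) := by
      push_cast; linear_combination h
    exact (cast_eq_iff hb (by omega)).1 h'
  · right
    have h' : ((b + 1 : ℕ) : ZMod ℓ) = ((a : ℕ) : ZMod ℓ) := by
      push_cast; linear_combination h
    by_cases hbl : b + 1 < ℓ
    · have := (cast_eq_iff hbl (by omega)).1 h'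
      omega
    · have hbl : b + 1 = ℓ := by omega
      refine ⟨?_, hbl⟩
      rw [hbl, ZMod.natCast_self] at h'
      have hl0 : 0 < ℓ := by omega
      have hal : a < ℓ := by omega
      exact ((cast_eq_iff (ℓ := ℓ) (a := 0) (b := a) hl0 hal).1 (by simpa using h')).symm

theorem lastBag {i : ZMod ℓ} (h5 : 5 ≤ ℓ) : i + ((ℓ - 1 : ℕ) : ZMod ℓ) = i - 1 := by
  rw [Nat.cast_sub (by omega), ZMod.natCast_self]; push_cast; ring

/-- closing up a path around the buoy -/
theorem closeUp (heven : ¬ HasEvenHole G) (hodd : Odd ℓ) (hB : IsBuoy G ℓ B) (i : ZMod ℓ)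
    (g : ℕ → V) (hg : ∀ k, k < ℓ → g k ∈ B (i + k)) (hga : ∀ k, k + 1 < ℓ → G.Adj (g k) (g (k + 1)))
    (w : V) (hw : w ∈ B (i - 1)) (hw0 : G.Adj w (g 0)) :
    G.Adj (g (ℓ - 2)) w ∨ G.Adj (g (ℓ - 1)) (g 0) := by
  by_contra hc
  push Not at hc
  obtain ⟨hc1, hc2⟩ := hc
  have h5 := hB.1
  have hw' : w ∈ B (i + ((ℓ - 1 : ℕ) : ZMod ℓ)) := by rw [lastBag h5]; exact hw
  have hwl : g (ℓ - 1) ≠ w := by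
    rintro rfl
    exact hc2 hw0
  have hwa : G.Adj (g (ℓ - 1)) w := hB.2.2.1 _ (hg (ℓ - 1) (by omega)) hw' hwl
  refine noEven heven (ℓ + 1) (by omega) hodd.add_one (fun k => if k < ℓ then g k else w) ?_ ?_
  · intro a b hab hb
    simp only [show a < ℓ by omega, if_true]
    by_cases hbl : b < ℓ
    · simp only [hbl, if_true]
      exact nat_ne hB hab hbl (hg a (by omega)) (hg b hbl)
    · simp only [hbl, if_false]
      by_cases hal : a = ℓ - 1
      · rw [hal]; exact hwl
      · exact nat_ne hB (by omega) (by omega) (hg a (by omega)) hw'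
  · intro a b hab hb
    simp only [show a < ℓ by omega, if_true]
    by_cases hbl : b < ℓ
    · simp only [hbl, if_true]
      constructor
      · intro h
        rcases nat_adj hB hab hbl (hg a (by omega)) (hg b hbl) h with h' | ⟨h', h''⟩
        · exact Or.inl h'
        · exfalso
          apply hc2
          have : b = ℓ - 1 := by omega
          rw [← this, ← h']; exact h.symm
      · rintro (h | h)
        · rw [h]; exact hga a (by omega)
        · omega
    · simp only [hbl, if_false]
      have hbe : b = ℓ := by omega
      by_cases hal : a = ℓ - 1
      · constructor
        · intro _; left; omega
        · intro _; rw [hal]; exact hwa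
      · constructor
        · intro h
          rcases nat_adj hB (by omega) (by omega) (hg a (by omega)) hw' h with h' | h'
          · exfalso
            apply hc1
            have : ℓ - 2 = a := by omega
            rw [this]; exact h
          · right; omega
        · rintro (h | h)
          · omega
          · rw [h.1]; exact hw0.symm

theorem Tr.mem {h : ZMod ℓ → V} (hh : Tr G B h) (i : ZMod ℓ) : h i ∈ B i := (hh i).1

theorem Tr.adj_iff (hB : IsBuoy G ℓ B) {h : ZMod ℓ → V} (hh : Tr G B h) (i : ZMod ℓ)
    {a b : ℕ} (hab : a < b) (hb : b < ℓ) :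
    G.Adj (h (i + a)) (h (i + b)) ↔ (b = a + 1 ∨ (a = 0 ∧ b + 1 = ℓ)) := by
  constructor
  · exact fun h' => nat_adj hB hab hb (hh.mem _) (hh.mem _) h'
  · rintro (rfl | ⟨rfl, hb'⟩)
    · have := (hh (i + a)).2
      push_cast; rwa [← add_assoc]
    · have := (hh (i + b)).2
      have e : i + (b : ZMod ℓ) + 1 = i + ((0 : ℕ) : ZMod ℓ) := by
        have : ((b + 1 : ℕ) : ZMod ℓ) = 0 := by rw [hb', ZMod.natCast_self]
        push_cast at this ⊢
        linear_combination this
      rw [e] at this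
      exact this.symm

theorem sub_decomp (h5 : 5 ≤ ℓ) (i j : ZMod ℓ) : ∃ k : ℕ, k < ℓ ∧ j = i + k := by
  have : NeZero ℓ := ⟨by omega⟩
  exact ⟨(j - i).val, ZMod.val_lt _, by rw [ZMod.natCast_zmod_val]; ring⟩

/-- make a transversal hole from a natural-number indexed sequence -/
theorem mkTr (h5 : 5 ≤ ℓ) (i : ZMod ℓ)
    (g : ℕ → V) (hg : ∀ k, k < ℓ → g k ∈ B (i + k)) (hga : ∀ k, k + 1 < ℓ → G.Adj (g k) (g (k + 1)))
    (hl : G.Adj (g (ℓ - 1)) (g 0)) : ∃ h, Tr G B h ∧ ∀ k, k < ℓ → h (i + k) = g k := by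
  have : NeZero ℓ := ⟨by omega⟩
  have key : ∀ k, k < ℓ → g ((i + (k : ZMod ℓ)) - i).val = g k := by
    intro k hk
    rw [add_sub_cancel_left, ZMod.val_natCast, Nat.mod_eq_of_lt hk]
  refine ⟨fun j => g (j - i).val, ?_, key⟩
  intro j
  obtain ⟨k, hk, rfl⟩ := sub_decomp h5 i j
  simp only
  rw [key k hk]
  refine ⟨hg k hk, ?_⟩
  by_cases hk' : k + 1 < ℓ
  · have := key (k + 1) hk'
    push_cast at this
    rw [add_assoc, this]
    exact hga k hk'
  · have e : i + (k : ZMod ℓ) + 1 = i + ((0 : ℕ) : ZMod ℓ) := by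
      have : ((k + 1 : ℕ) : ZMod ℓ) = 0 := by
        rw [show k + 1 = ℓ by omega, ZMod.natCast_self]
      push_cast at this ⊢
      linear_combination this
    rw [e, key 0 (by omega), show k = ℓ - 1 by omega]
    exact hl

theorem exTr (heven : ¬ HasEvenHole G) (hodd : Odd ℓ) (hB : IsBuoy G ℓ B) (i : ZMod ℓ)
    (b : V) (hb : b ∈ B i) : ∃ h, Tr G B h ∧ h i = b := by
  have h5 := hB.1
  have step : ∀ (v : V), ∃ u, ∀ j, v ∈ B j → u ∈ B (j + 1) ∧ G.Adj v u := by
    intro v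
    by_cases hv : ∃ j, v ∈ B j
    · obtain ⟨j, hj⟩ := hv
      obtain ⟨u, hu, huv⟩ := hB.2.2.2.2.1 j v hj
      refine ⟨u, fun j' hj' => ?_⟩
      have : j' = j := by
        by_contra hne
        exact bag_ne hB hne hj' hj rfl
      subst this
      exact ⟨hu, huv⟩
    · exact ⟨v, fun j hj => (hv ⟨j, hj⟩).elim⟩
  choose nx hnx using step
  let g : ℕ → V := fun k => nx^[k] b
  have gs : ∀ k, g (k + 1) = nx (g k) := fun k => Function.iterate_succ_apply' nx k b
  have hg : ∀ k : ℕ, g k ∈ B (i + k) := by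
    intro k
    induction k with
    | zero => simpa [g] using hb
    | succ k ih =>
      rw [gs]; push_cast; rw [← add_assoc]
      exact (hnx _ _ ih).1
  have hga : ∀ k, G.Adj (g k) (g (k + 1)) := by
    intro k
    rw [gs]
    exact (hnx _ _ (hg k)).2
  obtain ⟨w, hw, hwb⟩ := hB.2.2.2.2.2.1 i b hb
  have fin : ∀ g' : ℕ → V, (∀ k, k < ℓ → g' k ∈ B (i + k)) →
      (∀ k, k + 1 < ℓ → G.Adj (g' k) (g' (k + 1))) → G.Adj (g' (ℓ - 1)) (g' 0) → g' 0 = b →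
      ∃ h, Tr G B h ∧ h i = b := by
    intro g' h1 h2 h3 h4
    obtain ⟨h, hh, hk⟩ := mkTr h5 i g' h1 h2 h3
    refine ⟨h, hh, ?_⟩
    have := hk 0 (by omega)
    simpa [h4] using this
  rcases closeUp heven hodd hB i g (fun k _ => hg k) (fun k _ => hga k) w hw hwb.symm with h | h
  · refine fin (fun k => if k = ℓ - 1 then w else g k) ?_ ?_ ?_ ?_
    · intro k hk
      by_cases hkl : k = ℓ - 1
      · simp only [hkl, if_true]; rw [lastBag h5]; exact hw
      · simp only [hkl, if_false]; exact hg k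
    · intro k hk
      simp only [show k ≠ ℓ - 1 by omega, if_false]
      by_cases hkl : k + 1 = ℓ - 1
      · simp only [hkl, if_true]; rw [show k = ℓ - 2 by omega]; exact h
      · simp only [hkl, if_false]; exact hga k
    · simp only [if_true, show (0 : ℕ) ≠ ℓ - 1 by omega, if_false]; exact hwb.symm
    · simp only [show (0 : ℕ) ≠ ℓ - 1 by omega, if_false]; rfl
  · exact fin g (fun k _ => hg k) (fun k _ => hga k) h rfl

theorem Tr.noPan (hpan : ¬ HasInducedPan G) (hB : IsBuoy G ℓ B) {h : ZMod ℓ → V} (hh : Tr G B h)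
    (y : V) (hy : ∀ i, y ≠ h i) (j : ZMod ℓ) (hj : G.Adj y (h j))
    (hu : ∀ i, G.Adj y (h i) → i = j) : False := by
  have h5 := hB.1
  refine _root_.noPan hpan ℓ (by omega) (fun k => h (j + k)) ?_ ?_ y (fun a _ => hy _) 0 (by omega)
    (by simpa using hj) ?_
  · intro a b hab hb
    exact nat_ne hB hab hb (hh.mem _) (hh.mem _)
  · intro a b hab hb
    exact hh.adj_iff hB j hab hb
  · intro a ha h'
    have := hu _ h'
    exact (cast_eq_iff ha (by omega)).1 (by push_cast; linear_combination this)

/-- one-sided replacement -/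
theorem replL (heven : ¬ HasEvenHole G) (hodd : Odd ℓ) (hB : IsBuoy G ℓ B)
    {h : ZMod ℓ → V} (hh : Tr G B h) (j : ZMod ℓ) (v : V) (hv : v ∈ B j) (hvj : v ≠ h j)
    (hv1 : G.Adj v (h (j + 1))) (hv2 : ¬ G.Adj v (h (j - 1))) :
    ∃ u ∈ B (j - 1), G.Adj u v ∧ G.Adj (h (j - 1 - 1)) u ∧ G.Adj u (h j) := by
  have h5 := hB.1
  obtain ⟨z1, z2, z3, z4⟩ := zne h5
  obtain ⟨u, hu, huv⟩ := hB.2.2.2.2.2.1 j v hv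
  have hune : h (j - 1) ≠ u := by
    rintro rfl
    exact hv2 huv
  have hprev : G.Adj (h (j - 1)) (h j) := by simpa using (hh (j - 1)).2
  refine ⟨u, hu, huv.symm, ?_, ?_⟩
  · have P1 : ∀ k : ℕ, k < ℓ → (fun k : ℕ => if k = 0 then v else h (j + k)) k ∈ B (j + k) := by
      intro k hk
      by_cases hk0 : k = 0
      · simpa [hk0] using hv
      · simp only [hk0, if_false]; exact hh.mem _
    have P2 : ∀ k : ℕ, k + 1 < ℓ → G.Adj ((fun k : ℕ => if k = 0 then v else h (j + k)) k)
        ((fun k : ℕ => if k = 0 then v else h (j + k)) (k + 1)) := by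
      intro k hk
      by_cases hk0 : k = 0
      · simpa [hk0] using hv1
      · simp only [hk0, if_false, show k + 1 ≠ 0 by omega]
        push_cast; rw [← add_assoc]; exact (hh _).2
    rcases closeUp heven hodd hB j _ P1 P2 u hu huv.symm with h' | h'
    · simp only [show ℓ - 2 ≠ 0 by omega, if_false] at h'
      have e : j + ((ℓ - 2 : ℕ) : ZMod ℓ) = j - 1 - 1 := by
        rw [Nat.cast_sub (by omega), ZMod.natCast_self]; push_cast; ring
      rwa [e] at h'
    · simp only [show ℓ - 1 ≠ 0 by omega, if_false, if_true] at h'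
      rw [lastBag h5] at h'
      exact (hv2 h'.symm).elim
  · have hne : v ≠ h (j - 1) :=
      bag_ne hB (by intro e; apply z1; linear_combination e) hv (hh.mem _)
    have hne2 : u ≠ h j :=
      bag_ne hB (by intro e; apply z1; linear_combination -e) hu (hh.mem _)
    exact noC4 heven huv (hB.2.2.1 _ hu (hh.mem _) hune.symm) hprev
      (hB.2.2.1 _ (hh.mem _) hv hvj.symm) hv2 hne hne2

theorem IsBuoy.neg (hB : IsBuoy G ℓ B) : IsBuoy G ℓ (fun i => B (-i)) := by
  obtain ⟨h1, h2, h3, h4, h5, h6, h7⟩ := hB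
  refine ⟨h1, fun i => h2 _, fun i => h3 _, ?_, ?_, ?_, ?_⟩
  · intro i j hij
    exact h4 (fun h => hij (neg_injective h))
  · intro i v hv
    have := h6 (-i) v hv
    rwa [show -i - 1 = -(i + 1) by ring] at this
  · intro i v hv
    have := h5 (-i) v hv
    rwa [show -i + 1 = -(i - 1) by ring] at this
  · intro i j n1 n2 n3
    refine h7 (-i) (-j) ?_ ?_ ?_
    · exact fun h => n1 (neg_injective h)
    · intro h; apply n3; linear_combination -h
    · intro h; apply n2; linear_combination -h

theorem Tr.neg {h : ZMod ℓ → V} (hh : Tr G B h) :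
    Tr G (fun i => B (-i)) (fun i => h (-i)) := by
  intro i
  refine ⟨hh.mem _, ?_⟩
  have := (hh (-(i + 1))).2
  rw [show -(i + 1) + 1 = -i by ring] at this
  exact this.symm

theorem replR (heven : ¬ HasEvenHole G) (hodd : Odd ℓ) (hB : IsBuoy G ℓ B)
    {h : ZMod ℓ → V} (hh : Tr G B h) (j : ZMod ℓ) (v : V) (hv : v ∈ B j) (hvj : v ≠ h j)
    (hv1 : G.Adj v (h (j - 1))) (hv2 : ¬ G.Adj v (h (j + 1))) :
    ∃ u ∈ B (j + 1), G.Adj u v ∧ G.Adj u (h (j + 1 + 1)) ∧ G.Adj u (h j) := by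
  obtain ⟨u, hu, h1, h2, h3⟩ := replL heven hodd hB.neg hh.neg (-j) v (by simpa using hv)
    (by simpa using hvj) (by rwa [show -(-j + 1) = j - 1 by ring])
    (by rwa [show -(-j - 1) = j + 1 by ring])
  rw [show -(-j - 1) = j + 1 by ring] at hu
  rw [show -(-j - 1 - 1) = j + 1 + 1 by ring] at h2
  rw [neg_neg] at h3
  exact ⟨u, hu, h1, h2.symm, h3⟩

theorem Tr.update (h5 : 5 ≤ ℓ) {h : ZMod ℓ → V} (hh : Tr G B h) (j : ZMod ℓ) (v : V)
    (hv : v ∈ B j) (h1 : G.Adj v (h (j + 1))) (h2 : G.Adj (h (j - 1)) v) :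
    Tr G B (Function.update h j v) := by
  obtain ⟨z1, -⟩ := zne h5
  intro i
  by_cases hi : i = j
  · subst hi
    refine ⟨by simpa using hv, ?_⟩
    rw [Function.update_self, Function.update_of_ne]
    · exact h1
    · intro e; apply z1; linear_combination e
  · rw [Function.update_of_ne hi]
    refine ⟨hh.mem _, ?_⟩
    by_cases hi' : i + 1 = j
    · subst hi'
      simpa using h2
    · rw [Function.update_of_ne hi']; exact (hh i).2

/-- replacement: all cases at once -/
theorem repl (hpan : ¬ HasInducedPan G) (heven : ¬ HasEvenHole G) (hodd : Odd ℓ)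
    (hB : IsBuoy G ℓ B)
    {h : ZMod ℓ → V} (hh : Tr G B h) (j : ZMod ℓ) (v : V) (hv : v ∈ B j) (hvj : v ≠ h j) :
    Tr G B (Function.update h j v) ∨
    (∃ u, Tr G B (Function.update h (j - 1) u) ∧
      Tr G B (Function.update (Function.update h (j - 1) u) j v)) ∨
    (∃ u, Tr G B (Function.update h (j + 1) u) ∧
      Tr G B (Function.update (Function.update h (j + 1) u) j v)) := by
  have h5 := hB.1
  obtain ⟨z1, z2, z3, z4⟩ := zne h5
  by_cases c1 : G.Adj v (h (j + 1)) <;> by_cases c2 : G.Adj v (h (j - 1))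
  · exact Or.inl (hh.update h5 j v hv c1 c2.symm)
  · right; left
    obtain ⟨u, hu, h1, h2, h3⟩ := replL heven hodd hB hh j v hv hvj c1 c2
    have t := hh.update h5 (j - 1) u hu (by simpa using h3) h2
    refine ⟨u, t, t.update h5 j v hv ?_ ?_⟩
    · rwa [Function.update_of_ne]
      intro e; apply z2; linear_combination e
    · simpa using h1
  · right; right
    obtain ⟨u, hu, h1, h2, h3⟩ := replR heven hodd hB hh j v hv hvj c2 c1
    have t := hh.update h5 (j + 1) u hu h2 (by simpa using h3.symm)
    refine ⟨u, t, t.update h5 j v hv ?_ ?_⟩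
    · simpa using h1.symm
    · rw [Function.update_of_ne]
      · exact c2.symm
      · intro e; apply z2; linear_combination -e
  · exfalso
    refine hh.noPan hpan hB v ?_ j (hB.2.2.1 _ hv (hh.mem _) hvj) ?_
    · intro i
      by_cases hi : i = j
      · rw [hi]; exact hvj
      · exact bag_ne hB (Ne.symm hi) hv (hh.mem _)
    · intro i hi
      rcases bag_adj hB hv (hh.mem _) hi with e | e | e
      · exact e
      · rw [e] at hi; exact (c1 hi).elim
      · rw [e] at hi; exact (c2 hi).elim

/-- the sector cycle -/
def secF (x : V) (h : ZMod ℓ → V) (i : ZMod ℓ) : ℕ → V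
  | 0 => x
  | k + 1 => h (i + k)

theorem sec_hole (hB : IsBuoy G ℓ B) {h : ZMod ℓ → V} (hh : Tr G B h) {x : V}
    (hx : ∀ i, x ≠ h i) (i : ZMod ℓ) (p : ℕ) (hp : p + 2 ≤ ℓ)
    (h0 : G.Adj x (h i)) (hpp : G.Adj x (h (i + p)))
    (hmid : ∀ k : ℕ, 0 < k → k < p → ¬ G.Adj x (h (i + k))) :
    (∀ a b, a < b → b < p + 2 → secF x h i a ≠ secF x h i b) ∧
    (∀ a b, a < b → b < p + 2 →
      (G.Adj (secF x h i a) (secF x h i b) ↔ (b = a + 1 ∨ (a = 0 ∧ b + 1 = p + 2)))) := by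
  constructor
  · intro a b hab hb
    obtain ⟨b, rfl⟩ : ∃ c, b = c + 1 := ⟨b - 1, by omega⟩
    cases a with
    | zero => exact hx _
    | succ a => exact nat_ne hB (by omega) (by omega) (hh.mem (i + (a : ZMod ℓ))) (hh.mem (i + (b : ZMod ℓ)))
  · intro a b hab hb
    obtain ⟨b, rfl⟩ : ∃ c, b = c + 1 := ⟨b - 1, by omega⟩
    cases a with
    | zero =>
      simp only [secF]
      by_cases hb0 : b = 0
      · subst hb0
        simpa using h0
      · by_cases hbp : b = p
        · subst hbp
          simpa using hpp
        · have := hmid b (by omega) (by omega)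
          simp only [this, false_iff]
          omega
    | succ a =>
      simp only [secF]
      rw [hh.adj_iff hB i (by omega) (by omega)]
      omega

theorem sec_even (heven : ¬ HasEvenHole G) (hB : IsBuoy G ℓ B) {h : ZMod ℓ → V} (hh : Tr G B h)
    {x : V} (hx : ∀ i, x ≠ h i) (i : ZMod ℓ) (p : ℕ) (hp2 : 2 ≤ p) (hp : p + 2 ≤ ℓ)
    (h0 : G.Adj x (h i)) (hpp : G.Adj x (h (i + p)))
    (hmid : ∀ k : ℕ, 0 < k → k < p → ¬ G.Adj x (h (i + k))) : ¬ Even p := by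
  intro hev
  obtain ⟨h1, h2⟩ := sec_hole hB hh hx i p hp h0 hpp hmid
  exact noEven heven (p + 2) (by omega) (hev.add (by decide)) _ h1 h2

theorem sec_pan (hpan : ¬ HasInducedPan G) (hB : IsBuoy G ℓ B) {h : ZMod ℓ → V} (hh : Tr G B h)
    {x : V} (hx : ∀ i, x ≠ h i) (i : ZMod ℓ) (p : ℕ) (hp2 : 2 ≤ p) (hp : p + 2 ≤ ℓ)
    (h0 : G.Adj x (h i)) (hpp : G.Adj x (h (i + p)))
    (hmid : ∀ k : ℕ, 0 < k → k < p → ¬ G.Adj x (h (i + k)))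
    (q : ℕ) (hpq : p < q) (hq : q < ℓ) :
    (q ≠ p + 1 → q + 1 ≠ ℓ → ¬ G.Adj x (h (i + q))) ∧
    (q = p + 1 → q + 1 ≠ ℓ → G.Adj x (h (i + q))) ∧
    (q ≠ p + 1 → q + 1 = ℓ → G.Adj x (h (i + q))) := by
  obtain ⟨h1, h2⟩ := sec_hole hB hh hx i p hp h0 hpp hmid
  have P := noPan hpan (p + 2) (by omega) _ h1 h2 (h (i + q)) (by
    intro a ha
    cases a with
    | zero => exact (hx _).symm
    | succ a => exact (nat_ne hB (by omega) hq (hh.mem (i + (a : ZMod ℓ))) (hh.mem (i + (q : ZMod ℓ)))).symm)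
  have A : ∀ a : ℕ, a < p + 1 → (G.Adj (h (i + q)) (h (i + a)) ↔ q = a + 1 ∨ (a = 0 ∧ q + 1 = ℓ)) := by
    intro a ha
    rw [G.adj_comm]
    exact hh.adj_iff hB i (by omega) hq
  refine ⟨fun n1 n2 hA => ?_, fun n1 n2 => ?_, fun n1 n2 => ?_⟩
  · refine P 0 (by omega) hA.symm ?_
    intro a ha h'
    cases a with
    | zero => rfl
    | succ a =>
      have := (A a (by omega)).1 h'
      omega
  · by_contra hA
    refine P (p + 1) (by omega) ((A p (by omega)).2 (by omega)) ?_
    intro a ha h'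
    cases a with
    | zero => exact (hA h'.symm).elim
    | succ a =>
      have := (A a (by omega)).1 h'
      omega
  · by_contra hA
    refine P 1 (by omega) ((A 0 (by omega)).2 (by omega)) ?_
    intro a ha h'
    cases a with
    | zero => exact (hA h'.symm).elim
    | succ a =>
      have := (A a (by omega)).1 h'
      omega

/-- the neighbourhood of x on a transversal hole -/
theorem nbrs (hpan : ¬ HasInducedPan G) (heven : ¬ HasEvenHole G) (hodd : Odd ℓ)
    (hB : IsBuoy G ℓ B) {h : ZMod ℓ → V} (hh : Tr G B h)
    {x : V} (hx : ∀ i, x ≠ h i) (hsome : ∃ i, G.Adj x (h i)) :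
    (∀ i, G.Adj x (h i)) ∨ ∃ i, (∀ j, G.Adj x (h j) ↔ (j = i ∨ j = i + 1)) ∨
      (∀ j, G.Adj x (h j) ↔ (j = i ∨ j = i + 1 ∨ j = i + 1 + 1)) := by
  have h5 := hB.1
  by_cases hall : ∀ i, G.Adj x (h i)
  · exact Or.inl hall
  right
  have hstart : ∃ i, G.Adj x (h i) ∧ ¬ G.Adj x (h (i + 1)) := by
    by_contra hc
    push Not at hc
    obtain ⟨i, hi⟩ := hsome
    apply hall
    have : ∀ k : ℕ, G.Adj x (h (i + k)) := by
      intro k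
      induction k with
      | zero => simpa using hi
      | succ k ih => push_cast; rw [← add_assoc]; exact hc _ ih
    intro j
    obtain ⟨k, -, rfl⟩ := sub_decomp h5 i j
    exact this k
  obtain ⟨i, hi, hi1⟩ := hstart
  have hex : ∃ p : ℕ, 0 < p ∧ G.Adj x (h (i + p)) := ⟨ℓ, by omega, by simpa using hi⟩
  classical
  obtain ⟨hp0, hpp⟩ := Nat.find_spec hex
  have hmin := fun k (hk : k < Nat.find hex) => Nat.find_min hex hk
  have hple : Nat.find hex ≤ ℓ := Nat.find_min' hex ⟨by omega, by simpa using hi⟩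
  generalize Nat.find hex = p at *
  have hmid : ∀ k : ℕ, 0 < k → k < p → ¬ G.Adj x (h (i + k)) := by
    intro k hk hkp hA
    exact hmin k hkp ⟨hk, hA⟩
  have hp2 : 2 ≤ p := by
    by_contra hlt
    have : p = 1 := by omega
    subst this
    exact hi1 (by simpa using hpp)
  -- case p = ℓ
  by_cases hpl : p = ℓ
  · exfalso
    refine hh.noPan hpan hB x hx i hi ?_
    intro j hj
    obtain ⟨k, hk, rfl⟩ := sub_decomp h5 i j
    by_cases hk0 : k = 0
    · simp [hk0]
    · exact (hmid k (by omega) (by omega) hj).elim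
  by_cases hpl1 : p = ℓ - 1
  · refine ⟨i - 1, Or.inl ?_⟩
    intro j
    constructor
    · intro hj
      obtain ⟨k, hk, rfl⟩ := sub_decomp h5 i j
      by_cases hk0 : k = 0
      · right; simp [hk0]
      · by_cases hkp : k = ℓ - 1
        · left; rw [hkp, lastBag h5]
        · exact (hmid k (by omega) (by omega) hj).elim
    · rintro (rfl | rfl)
      · rw [hpl1, lastBag h5] at hpp; exact hpp
      · simpa using hi
  have hp : p + 2 ≤ ℓ := by omega
  have hpe := sec_even heven hB hh hx i p hp2 hp hi hpp hmid
  have hpn := sec_pan hpan hB hh hx i p hp2 hp hi hpp hmid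
  by_cases hpl2 : p = ℓ - 2
  · have e2 : i + (p : ZMod ℓ) = i - 1 - 1 := by
      rw [hpl2, Nat.cast_sub (by omega), ZMod.natCast_self]; push_cast; ring
    rw [e2] at hpp
    have hm1 : G.Adj x (h (i - 1)) := by
      by_contra hn
      refine sec_even heven hB hh hx (i - 1 - 1) 2 le_rfl (by omega) hpp ?_ ?_ (by decide)
      · rw [show i - 1 - 1 + ((2 : ℕ) : ZMod ℓ) = i by push_cast; ring]; exact hi
      · intro k hk hk2
        have : k = 1 := by omega
        subst this
        rw [show i - 1 - 1 + ((1 : ℕ) : ZMod ℓ) = i - 1 by push_cast; ring]; exact hn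
    refine ⟨i - 1 - 1, Or.inr ?_⟩
    intro j
    constructor
    · intro hj
      obtain ⟨k, hk, rfl⟩ := sub_decomp h5 i j
      by_cases hk0 : k = 0
      · right; right; simp [hk0]
      · by_cases hkp : k = ℓ - 1
        · right; left; rw [hkp, lastBag h5]; ring
        · by_cases hkp2 : k = p
          · left; rw [hkp2, e2]
          · exact (hmid k (by omega) (by omega) hj).elim
    · rintro (rfl | rfl | rfl)
      · exact hpp
      · simpa using hm1
      · simpa using hi
  exfalso
  have hpl3 : p + 4 ≤ ℓ := by
    by_contra hlt
    have : ℓ = p + 3 := by omega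
    apply hpe
    rw [this] at hodd
    rcases hodd with ⟨m, hm⟩
    exact ⟨m - 1, by omega⟩
  have a1 := (hpn (p + 1) (by omega) (by omega)).2.1 rfl (by omega)
  have a2 := (hpn (ℓ - 1) (by omega) (by omega)).2.2 (by omega) (by omega)
  refine sec_even heven hB hh hx (i + ((p + 1 : ℕ) : ZMod ℓ)) (ℓ - 2 - p) (by omega) (by omega)
    a1 ?_ ?_ ?_
  · rw [add_assoc, ← Nat.cast_add, show p + 1 + (ℓ - 2 - p) = ℓ - 1 by omega]; exact a2
  · intro k hk hkp
    rw [add_assoc, ← Nat.cast_add]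
    exact (hpn (p + 1 + k) (by omega) (by omega)).1 (by omega) (by omega)
  · rw [Nat.not_even_iff_odd] at hpe
    obtain ⟨m, hm⟩ := hodd
    obtain ⟨m', hm'⟩ := hpe
    exact ⟨m - m' - 1, by omega⟩

theorem Tr.ne_x {h : ZMod ℓ → V} (hh : Tr G B h) {x : V} (hx : x ∉ ⋃ j, B j) (i : ZMod ℓ) :
    x ≠ h i := by
  rintro rfl
  exact hx (Set.mem_iUnion.2 ⟨i, hh.mem i⟩)

theorem no_miss (hpan : ¬ HasInducedPan G) (heven : ¬ HasEvenHole G) (hodd : Odd ℓ)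
    (hB : IsBuoy G ℓ B) {h : ZMod ℓ → V} (hh : Tr G B h)
    {x : V} (hx : x ∉ ⋃ j, B j) (j : ZMod ℓ) (hj : ¬ G.Adj x (h j))
    (ho : ∀ i, i ≠ j → G.Adj x (h i)) : False := by
  obtain ⟨z1, z2, z3, z4⟩ := zne hB.1
  have o1 := ho (j + 1) (by intro e; apply z1; linear_combination e)
  have o2 := ho (j + 2) (by intro e; apply z2; linear_combination e)
  have o3 := ho (j + 3) (by intro e; apply z3; linear_combination e)
  have o4 := ho (j + 4) (by intro e; apply z4; linear_combination e)
  rcases nbrs hpan heven hodd hB hh (hh.ne_x hx) ⟨_, o1⟩ with h' | ⟨i, h' | h'⟩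
  · exact hj (h' j)
  · rw [h'] at o1 o2 o3 o4 hj
    grind
  · rw [h'] at o1 o2 o3 o4 hj
    grind

theorem complete_of (hpan : ¬ HasInducedPan G) (heven : ¬ HasEvenHole G) (hodd : Odd ℓ)
    (hB : IsBuoy G ℓ B) {h : ZMod ℓ → V} (hh : Tr G B h)
    {x : V} (hx : x ∉ ⋃ j, B j) (hall : ∀ i, G.Adj x (h i)) (b : V) (hb : b ∈ ⋃ j, B j) :
    G.Adj x b := by
  obtain ⟨z1, z2, z3, z4⟩ := zne hB.1
  obtain ⟨j, hbj⟩ := Set.mem_iUnion.1 hb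
  by_contra hn
  have hne : b ≠ h j := by rintro rfl; exact hn (hall j)
  have one : ∀ (k : ZMod ℓ) (u : V), Tr G B (Function.update h k u) → G.Adj x u := by
    intro k u ht
    by_contra hu
    refine no_miss hpan heven hodd hB ht hx k (by simpa using hu) ?_
    intro i hi
    rw [Function.update_of_ne hi]; exact hall i
  have two : ∀ (k : ZMod ℓ) (u : V), k ≠ j → Tr G B (Function.update h k u) →
      Tr G B (Function.update (Function.update h k u) j b) → False := by
    intro k u hk h1 h2
    have hu := one k u h1
    refine no_miss hpan heven hodd hB h2 hx j (by simpa using hn) ?_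
    intro i hi
    rw [Function.update_of_ne hi]
    by_cases hik : i = k
    · subst hik; simpa using hu
    · rw [Function.update_of_ne hik]; exact hall i
  rcases repl hpan heven hodd hB hh j b hbj hne with h' | ⟨u, h1, h2⟩ | ⟨u, h1, h2⟩
  · exact hn (one j b h')
  · exact two _ u (by intro e; apply z1; linear_combination -e) h1 h2
  · exact two _ u (by intro e; apply z1; linear_combination e) h1 h2

/-- description of hole neighbourhoods when not complete -/
def Nb (S : ZMod ℓ → Prop) : Prop :=
  ∃ i, (∀ j, S j ↔ (j = i ∨ j = i + 1)) ∨ (∀ j, S j ↔ (j = i ∨ j = i + 1 ∨ j = i + 1 + 1))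

theorem combi (h5 : 5 ≤ ℓ) (S S' : ZMod ℓ → Prop) (hS : Nb S) (hS' : Nb S') (j k : ZMod ℓ)
    (hj : ¬ S j) (hj' : S' j) (hk : k = j - 1 ∨ k = j + 1)
    (hsame : ∀ m, m ≠ j → m ≠ k → (S' m ↔ S m)) :
    ∃ i, (∀ m, S' m ↔ (m = i ∨ m = i + 1 ∨ m = i + 1 + 1)) ∧ ∀ m, S m → S' m := by
  obtain ⟨z1, z2, z3, z4⟩ := zne h5
  obtain ⟨i, hi⟩ := hS
  obtain ⟨i', hi'⟩ := hS'
  have hsame' : ∀ m, m = j ∨ m = k ∨ (S' m ↔ S m) := by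
    intro m
    by_cases h1 : m = j
    · exact Or.inl h1
    · by_cases h2 : m = k
      · exact Or.inr (Or.inl h2)
      · exact Or.inr (Or.inr (hsame m h1 h2))
  have s0 := hsame' i
  have s1 := hsame' (i + 1)
  have s2 := hsame' (i + 1 + 1)
  have t0 := hsame' i'
  have t1 := hsame' (i' + 1)
  have t2 := hsame' (i' + 1 + 1)
  clear hsame hsame'
  rcases hi' with hi' | hi'
  · exfalso
    rcases hi with hi | hi <;> simp only [hi, hi'] at s0 s1 s2 t0 t1 t2 hj hj' <;>
      clear hi hi' <;> rcases hk with rfl | rfl <;> rcases hj' with rfl | rfl <;> grind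
  · refine ⟨i', hi', ?_⟩
    intro m hm
    rcases hi with hi | hi <;> simp only [hi, hi'] at s0 s1 s2 t0 t1 t2 hj hj' hm ⊢ <;>
      clear hi hi' <;> rcases hk with rfl | rfl <;> rcases hj' with rfl | rfl | rfl <;> grind

theorem extend (hpan : ¬ HasInducedPan G) (heven : ¬ HasEvenHole G) (hodd : Odd ℓ)
    (hB : IsBuoy G ℓ B) {x : V} (hx : x ∉ ⋃ j, B j)
    (hnc : ∀ h, Tr G B h → ¬ ∀ i, G.Adj x (h i)) {h : ZMod ℓ → V} (hh : Tr G B h)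
    (hsome : ∃ i, G.Adj x (h i)) (j : ZMod ℓ) (b : V) (hb : b ∈ B j) (hxb : G.Adj x b)
    (hj : ¬ G.Adj x (h j)) :
    ∃ h', Tr G B h' ∧ ∃ i, (∀ m, G.Adj x (h' m) ↔ (m = i ∨ m = i + 1 ∨ m = i + 1 + 1)) ∧
      (∀ m, G.Adj x (h m) → G.Adj x (h' m)) ∧ G.Adj x (h' j) := by
  obtain ⟨z1, z2, z3, z4⟩ := zne hB.1
  have nb : ∀ h, Tr G B h → (∃ i, G.Adj x (h i)) → Nb (fun i => G.Adj x (h i)) := by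
    intro h hh hs
    rcases nbrs hpan heven hodd hB hh (hh.ne_x hx) hs with h' | h'
    · exact (hnc h hh h').elim
    · exact h'
  have fin : ∀ h', Tr G B h' → h' j = b → ∀ k, (k = j - 1 ∨ k = j + 1) →
      (∀ m, m ≠ j → m ≠ k → h' m = h m) → ∃ h', Tr G B h' ∧
      ∃ i, (∀ m, G.Adj x (h' m) ↔ (m = i ∨ m = i + 1 ∨ m = i + 1 + 1)) ∧
      (∀ m, G.Adj x (h m) → G.Adj x (h' m)) ∧ G.Adj x (h' j) := by
    intro h' t e k hk hs
    have hj' : G.Adj x (h' j) := by rw [e]; exact hxb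
    obtain ⟨i, hi, hm⟩ := combi hB.1 _ _ (nb h hh hsome) (nb h' t ⟨j, hj'⟩) j k hj hj' hk
      (by intro m h1 h2; simp only [hs m h1 h2])
    exact ⟨h', t, i, hi, hm, hj'⟩
  have hne : b ≠ h j := by rintro rfl; exact hj hxb
  rcases repl hpan heven hodd hB hh j b hb hne with h' | ⟨u, h1, h2⟩ | ⟨u, h1, h2⟩
  · refine fin _ h' (by simp) (j + 1) (Or.inr rfl) ?_
    intro m h1 h2
    rw [Function.update_of_ne h1]
  · refine fin _ h2 (by simp) (j - 1) (Or.inl rfl) ?_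
    intro m h1 h2
    rw [Function.update_of_ne h1, Function.update_of_ne h2]
  · refine fin _ h2 (by simp) (j + 1) (Or.inr rfl) ?_
    intro m h1 h2
    rw [Function.update_of_ne h1, Function.update_of_ne h2]

end buoy

theorem stmt_14 {V : Type*} (G : SimpleGraph V)
    (hpan : ¬ HasInducedPan G) (heven : ¬ HasEvenHole G)
    (ℓ : ℕ) (hodd : Odd ℓ) (B : ZMod ℓ → Set V) (hB : IsBuoy G ℓ B)
    (x : V) (hx : x ∉ ⋃ j, B j) (hnbr : ∃ b ∈ ⋃ j, B j, G.Adj x b) :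
    ((∀ i : ZMod ℓ, ∃ b ∈ B i, G.Adj x b) → ∀ b ∈ ⋃ j, B j, G.Adj x b) ∧
    (¬ (∀ i : ZMod ℓ, ∃ b ∈ B i, G.Adj x b) →
      ({i : ZMod ℓ | ∃ b ∈ B i, G.Adj x b}).ncard = 2 ∨
      (({i : ZMod ℓ | ∃ b ∈ B i, G.Adj x b}).ncard = 3 ∧
        ∃ i : ZMod ℓ, {j : ZMod ℓ | ∃ b ∈ B j, G.Adj x b} = {i - 1, i, i + 1})) := by
  have h5 := hB.1
  obtain ⟨z1, z2, z3, z4⟩ := zne h5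
  by_cases hc : ∃ h, Tr G B h ∧ ∀ i, G.Adj x (h i)
  · obtain ⟨h, hh, hall⟩ := hc
    refine ⟨fun _ b hb => complete_of hpan heven hodd hB hh hx hall b hb, fun hn => ?_⟩
    exact (hn fun i => ⟨h i, hh.mem i, hall i⟩).elim
  have hnc : ∀ h, Tr G B h → ¬ ∀ i, G.Adj x (h i) := fun h hh ha => hc ⟨h, hh, ha⟩
  -- the main classification of the set of bags
  have main : ∃ i, (∀ j, (∃ b ∈ B j, G.Adj x b) ↔ (j = i ∨ j = i + 1)) ∨
      (∀ j, (∃ b ∈ B j, G.Adj x b) ↔ (j = i ∨ j = i + 1 ∨ j = i + 1 + 1)) := by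
    obtain ⟨b, hb, hxb⟩ := hnbr
    obtain ⟨j, hbj⟩ := Set.mem_iUnion.1 hb
    obtain ⟨h, hh, rfl⟩ := exTr heven hodd hB j b hbj
    by_cases hT : ∀ k, (∃ b ∈ B k, G.Adj x b) → G.Adj x (h k)
    · have e : ∀ k, (∃ b ∈ B k, G.Adj x b) ↔ G.Adj x (h k) :=
        fun k => ⟨hT k, fun h' => ⟨_, hh.mem k, h'⟩⟩
      simp only [e]
      rcases nbrs hpan heven hodd hB hh (hh.ne_x hx) ⟨j, hxb⟩ with h' | h'
      · exact (hnc h hh h').elim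
      · exact h'
    · push Not at hT
      obtain ⟨k, ⟨b, hbk, hxb'⟩, hk⟩ := hT
      obtain ⟨h', t', i, hi, -, -⟩ := extend hpan heven hodd hB hx hnc hh ⟨j, hxb⟩ k b hbk hxb' hk
      refine ⟨i, Or.inr fun m => ?_⟩
      rw [← hi m]
      refine ⟨?_, fun h'' => ⟨_, t'.mem m, h''⟩⟩
      rintro ⟨c, hcm, hxc⟩
      by_contra hm
      obtain ⟨h2, t2, i2, hi2, hsub, hm2⟩ := extend hpan heven hodd hB hx hnc t'
        ⟨i, (hi i).2 (Or.inl rfl)⟩ m c hcm hxc hm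
      have s0 := hsub i ((hi _).2 (by simp))
      have s1 := hsub (i + 1) ((hi _).2 (by simp))
      have s2 := hsub (i + 1 + 1) ((hi _).2 (by simp))
      rw [hi2] at s0 s1 s2 hm2
      rw [hi] at hm
      grind
  obtain ⟨i, hi | hi⟩ := main
  · have e : {j : ZMod ℓ | ∃ b ∈ B j, G.Adj x b} = {i, i + 1} := by
      ext j; simpa using hi j
    refine ⟨fun ha => ?_, fun _ => Or.inl ?_⟩
    · have := (hi (i + 2)).1 (ha _)
      exfalso
      rcases this with e | e
      · apply z2; linear_combination e
      · apply z1; linear_combination e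
    · rw [e]
      exact Set.ncard_pair (by intro e; apply z1; linear_combination -e)
  · have e : {j : ZMod ℓ | ∃ b ∈ B j, G.Adj x b} = {i + 1 - 1, i + 1, i + 1 + 1} := by
      ext j; simpa using hi j
    refine ⟨fun ha => ?_, fun _ => Or.inr ⟨?_, i + 1, e⟩⟩
    · have := (hi (i + 3)).1 (ha _)
      exfalso
      rcases this with e | e | e
      · apply z3; linear_combination e
      · apply z2; linear_combination e
      · apply z1; linear_combination e
    · rw [e, Set.ncard_eq_three]
      exact ⟨_, _, _, by intro e; apply z1; linear_combination -e,
        by intro e; apply z2; linear_combination -e,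
        by intro e; apply z1; linear_combination -e, rfl⟩
end
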